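/- Let h ≥ 2 be an integer, let i0 be an integer with 1 ≤ i0 ≤ h−1, let c = (h+1−i0)(h+1), let B = {0, 1, h+1} ⊆ ℤ, and for 0 ≤ i ≤ h let L_i = (h−i)B + ic. Then for every integer i with 0 ≤ i ≤ h−1, L_i \ (⋃_{t=1}^{h−i} L_{i+t}) = L_i \ L_{i+1}; equivalently, L_i \ L_{i+1} ⊆ L_i \ L_{i+t} for all 1 ≤ t ≤ h−i. -/

import Mathlib

open Pointwise

/-- The `h`-fold sumset of a finite set of integers: `hsum 0 A = {0}`,
`hsum (n+1) A = A + hsum n A`. -/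
def hsum : ℕ → Finset ℤ → Finset ℤ
  | 0, _ => {0}
  | n + 1, A => A + hsum n A

theorem mem_hsum_zero_one_iff (g : ℤ) (n : ℕ) (x : ℤ) :
    x ∈ hsum n {0, 1, g} ↔ ∃ a b : ℕ, a + b ≤ n ∧ x = a + b * g := by
  induction n generalizing x with
  | zero =>
    simp only [hsum, Finset.mem_singleton]
    constructor
    · rintro rfl
      exact ⟨0, 0, le_rfl, by simp⟩
    · rintro ⟨a, b, hab, rfl⟩
      obtain ⟨rfl, rfl⟩ : a = 0 ∧ b = 0 := by omega
      simp
  | succ n ih =>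
    simp only [hsum, Finset.mem_add, Finset.mem_insert, Finset.mem_singleton]
    constructor
    · rintro ⟨y, hy, z, hz, rfl⟩
      obtain ⟨a, b, hab, rfl⟩ := (ih z).1 hz
      rcases hy with rfl | rfl | rfl
      · exact ⟨a, b, by omega, by ring⟩
      · exact ⟨a + 1, b, by omega, by push_cast; ring⟩
      · exact ⟨a, b + 1, by omega, by push_cast; ring⟩
    · rintro ⟨a, b, hab, rfl⟩
      rcases a with _ | a
      · rcases b with _ | b
        · exact ⟨0, by simp, 0, (ih 0).2 ⟨0, 0, by omega, by simp⟩, by simp⟩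
        · exact ⟨g, by simp, b * g, (ih _).2 ⟨0, b, by omega, by simp⟩, by push_cast; ring⟩
      · exact ⟨1, by simp, a + b * g, (ih _).2 ⟨a, b, by omega, rfl⟩, by push_cast; ring⟩

/-- If `x` lies in `mB` and in `(m - t)B + t k g`, where `B = {0, 1, g}` and `m < g`, then
it also lies in `(m - 1)B + k g`: the representation `a + b g` with `0 ≤ a < g` is unique. -/
theorem sub_mem_hsum_pred_of_mem_of_mem {g m k t : ℕ} (hm : m < g) (hk : 1 ≤ k) (ht : 1 ≤ t)
    {x y : ℤ} (hx : x ∈ hsum m {0, 1, (g : ℤ)}) (hy : y ∈ hsum (m - t) {0, 1, (g : ℤ)})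
    (hxy : x = y + t * (k * g)) :
    x - k * g ∈ hsum (m - 1) {0, 1, (g : ℤ)} := by
  obtain ⟨a, b, hab, rfl⟩ := (mem_hsum_zero_one_iff _ _ _).1 hx
  obtain ⟨p, q, hpq, rfl⟩ := (mem_hsum_zero_one_iff _ _ _).1 hy
  have hnat : a + g * b = p + g * (q + t * k) := by
    zify
    linarith
  have hb : b = q + t * k := by
    have hdiv := congrArg (· / g) hnat
    have hg : 0 < g := by omega
    simpa [Nat.add_mul_div_left _ _ hg, Nat.div_eq_of_lt (show a < g by omega),
      Nat.div_eq_of_lt (show p < g by omega)] using hdiv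
  have hkb : k ≤ b := by nlinarith
  refine (mem_hsum_zero_one_iff _ _ _).2 ⟨a, b - k, by omega, ?_⟩
  push_cast [hkb]
  ring

theorem stmt_17 (h : ℕ) (hh : 2 ≤ h) (i0 : ℕ) (hi0l : 1 ≤ i0) (hi0u : i0 ≤ h - 1)
    (c : ℤ) (hc : c = ((h : ℤ) + 1 - (i0 : ℤ)) * ((h : ℤ) + 1))
    (B : Finset ℤ) (hB : B = {0, 1, (h : ℤ) + 1})
    (L : ℕ → Finset ℤ)
    (hL : ∀ i, L i = (hsum (h - i) B).image (fun x => x + (i : ℤ) * c)) :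
    ∀ i : ℕ, i ≤ h - 1 →
      L i \ ((Finset.Icc 1 (h - i)).biUnion (fun t => L (i + t))) = L i \ L (i + 1) ∧
      ∀ t : ℕ, 1 ≤ t → t ≤ h - i → L i \ L (i + 1) ⊆ L i \ L (i + t) := by
  obtain ⟨k, hk, rfl⟩ : ∃ k : ℕ, 1 ≤ k ∧ c = k * ((h + 1 : ℕ) : ℤ) :=
    ⟨h + 1 - i0, by omega, by rw [hc, Nat.cast_sub (by omega)]; push_cast; ring⟩
  have hBg : B = {0, 1, ((h + 1 : ℕ) : ℤ)} := by rw [hB]; push_cast; rfl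
  intro i hi
  have key : ∀ t : ℕ, 1 ≤ t → ∀ x ∈ L i, x ∈ L (i + t) → x ∈ L (i + 1) := by
    intro t ht x hx hxt
    rw [hL, hBg, Finset.mem_image] at hx hxt ⊢
    obtain ⟨y, hy, rfl⟩ := hx
    obtain ⟨z, hz, hzy⟩ := hxt
    rw [← Nat.sub_sub] at hz ⊢
    refine ⟨_, sub_mem_hsum_pred_of_mem_of_mem (by omega) hk ht hy hz ?_, ?_⟩
    · push_cast at hzy ⊢
      linarith
    · push_cast
      ring
  have hsub : ∀ t : ℕ, 1 ≤ t → L i \ L (i + 1) ⊆ L i \ L (i + t) := by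
    intro t ht x hx
    rw [Finset.mem_sdiff] at hx ⊢
    exact ⟨hx.1, fun hxt => hx.2 (key t ht x hx.1 hxt)⟩
  refine ⟨Finset.Subset.antisymm ?_ ?_, fun t ht _ => hsub t ht⟩
  · exact Finset.sdiff_subset_sdiff le_rfl
      (Finset.subset_biUnion_of_mem (fun t => L (i + t)) (Finset.mem_Icc.2 ⟨le_rfl, by omega⟩))
  · intro x hx
    simp only [Finset.mem_sdiff, Finset.mem_biUnion, Finset.mem_Icc, not_exists, not_and]
    exact ⟨(Finset.mem_sdiff.1 hx).1, fun t ht => (Finset.mem_sdiff.1 (hsub t ht.1 hx)).2⟩
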